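/- Let R be a commutative ring and M an R-module. The following are equivalent: (1) for every R-linear map f : A → B between R-modules whose kernel is Q-torsion, the kernel of the induced map M ⊗_R A → M ⊗_R B is Q-torsion (M is τ_q-flat); (2) Tor_1^R(M, N) is Q-torsion for every R-module N; (3) Tor_1^R(R/I, M) is Q-torsion for every finitely generated ideal I of R. -/

import Mathlib

open Polynomial TensorProduct

universe u v

/-- An ideal is *semi-regular* if it contains a finitely generated dense subideal
(an ideal is *dense* if its annihilator is zero). -/
def Ideal.IsSemiregular {R : Type*} [CommRing R] (I : Ideal R) : Prop :=
  ∃ J : Ideal R, J ≤ I ∧ J.FG ∧ Submodule.annihilator J = ⊥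

/-- A module is *Q-torsion* if every element is annihilated by some finitely
generated semi-regular ideal. -/
def IsQTorsion (R : Type*) (M : Type*) [CommRing R] [AddCommGroup M] [Module R M] : Prop :=
  ∀ m : M, ∃ I : Ideal R, I.FG ∧ I.IsSemiregular ∧ ∀ a ∈ I, a • m = 0

open CategoryTheory in
/-- `Tor_1^R(M, N)` as an `R`-module. -/
noncomputable def Tor1Mod (R : Type u) [CommRing R] (M N : Type u)
    [AddCommGroup M] [Module R M] [AddCommGroup N] [Module R N] : ModuleCat R :=
  ((Tor (ModuleCat.{u} R) 1).obj (ModuleCat.of R M)).obj (ModuleCat.of R N)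

section QSaturation

variable {R : Type*} [CommRing R] {M N : Type*} [AddCommGroup M] [Module R M]
  [AddCommGroup N] [Module R N]

lemma Ideal.annihilator_mul_eq_bot {I J : Ideal R} (hI : Submodule.annihilator I = ⊥)
    (hJ : Submodule.annihilator J = ⊥) : Submodule.annihilator (I * J) = ⊥ := by
  refine (Submodule.eq_bot_iff _).2 fun c hc ↦ ?_
  rw [Submodule.mem_annihilator] at hc
  suffices c ∈ Submodule.annihilator I by simpa [hI] using this
  refine Submodule.mem_annihilator.2 fun i hi ↦ ?_
  suffices c • i ∈ Submodule.annihilator J by simpa [hJ] using this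
  refine Submodule.mem_annihilator.2 fun j hj ↦ ?_
  simpa [mul_assoc] using hc (i * j) (Ideal.mul_mem_mul hi hj)

lemma Ideal.IsSemiregular.mul {I J : Ideal R} (hI : I.IsSemiregular) (hJ : J.IsSemiregular) :
    (I * J).IsSemiregular := by
  obtain ⟨I', hI, fI, aI⟩ := hI
  obtain ⟨J', hJ, fJ, aJ⟩ := hJ
  exact ⟨I' * J', Ideal.mul_mono hI hJ, fI.mul fJ, annihilator_mul_eq_bot aI aJ⟩

variable (R) in
lemma Ideal.isSemiregular_top : (⊤ : Ideal R).IsSemiregular := by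
  refine ⟨⊤, le_rfl, Ideal.fg_top R, (Submodule.eq_bot_iff _).2 fun c hc ↦ ?_⟩
  simpa using Submodule.mem_annihilator.1 hc 1 trivial

/-- The elements that are carried into the submodule `S` by some finitely generated
semi-regular ideal. -/
def qSaturation (S : Submodule R M) : Submodule R M where
  carrier := {x | ∃ I : Ideal R, I.FG ∧ I.IsSemiregular ∧ ∀ a ∈ I, a • x ∈ S}
  zero_mem' := ⟨⊤, Ideal.fg_top R, Ideal.isSemiregular_top R, by simp⟩
  add_mem' := by
    rintro x y ⟨I, fI, sI, hI⟩ ⟨J, fJ, sJ, hJ⟩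
    refine ⟨I * J, fI.mul fJ, sI.mul sJ, fun a ha ↦ ?_⟩
    rw [smul_add]
    have h₁ : a ∈ I := Ideal.mul_le_left ha
    have h₂ : a ∈ J := Ideal.mul_le_right ha
    exact S.add_mem (hI a h₁) (hJ a h₂)
  smul_mem' := by
    rintro r x ⟨I, fI, sI, hI⟩
    refine ⟨I, fI, sI, fun a ha ↦ ?_⟩
    rw [smul_comm]
    exact S.smul_mem r (hI a ha)

lemma mem_qSaturation {S : Submodule R M} {x : M} :
    x ∈ qSaturation S ↔ ∃ I : Ideal R, I.FG ∧ I.IsSemiregular ∧ ∀ a ∈ I, a • x ∈ S :=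
  Iff.rfl

lemma qSaturation_mono {S T : Submodule R M} (h : S ≤ T) : qSaturation S ≤ qSaturation T :=
  fun _ ⟨I, fI, sI, hI⟩ ↦ ⟨I, fI, sI, fun a ha ↦ h (hI a ha)⟩

lemma qSaturation_comap (f : M →ₗ[R] N) (S : Submodule R N) :
    qSaturation (S.comap f) = (qSaturation S).comap f := by
  ext x
  simp [mem_qSaturation]

lemma map_mem_qSaturation_bot (f : M →ₗ[R] N) {x : M}
    (hx : x ∈ qSaturation (⊥ : Submodule R M)) : f x ∈ qSaturation (⊥ : Submodule R N) := by
  rw [← Submodule.mem_comap, ← qSaturation_comap]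
  exact qSaturation_mono bot_le hx

lemma mem_qSaturation_range {L : Type*} [AddCommGroup L] [Module R L] {f : L →ₗ[R] M}
    {g : M →ₗ[R] N} (h : Function.Exact f g) {x : M} :
    x ∈ qSaturation (LinearMap.range f) ↔ g x ∈ qSaturation (⊥ : Submodule R N) := by
  rw [← Submodule.mem_comap, ← qSaturation_comap, ← h.linearMap_ker_eq]
  rfl

lemma exists_ideal_smul_mem_of_mem_qSaturation {S : Submodule R M} (s : Finset M)
    (hs : ∀ x ∈ s, x ∈ qSaturation S) :
    ∃ J : Ideal R, J.FG ∧ J.IsSemiregular ∧ ∀ b ∈ J, ∀ x ∈ s, b • x ∈ S := by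
  induction s using Finset.cons_induction with
  | empty => exact ⟨⊤, Ideal.fg_top R, Ideal.isSemiregular_top R, by simp⟩
  | cons c s hc ih =>
    obtain ⟨J, fJ, sJ, hJ⟩ := ih fun x hx ↦ hs x (Finset.mem_cons_of_mem hx)
    obtain ⟨J', fJ', sJ', hJ'⟩ := hs c (Finset.mem_cons_self c s)
    refine ⟨J * J', Submodule.FG.mul fJ fJ', sJ.mul sJ', fun b hb x hx ↦ ?_⟩
    have h₁ : b ∈ J := Ideal.mul_le_left hb
    have h₂ : b ∈ J' := Ideal.mul_le_right hb
    obtain rfl | hx := Finset.mem_cons.1 hx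
    · exact hJ' b h₂
    · exact hJ b h₁ x hx

lemma qSaturation_idem (S : Submodule R M) : qSaturation (qSaturation S) = qSaturation S := by
  classical
  refine le_antisymm ?_ fun x hx ↦
    ⟨⊤, Ideal.fg_top R, Ideal.isSemiregular_top R, fun a _ ↦ Submodule.smul_mem _ a hx⟩
  rintro x ⟨I, fI, sI, hI⟩
  obtain ⟨s, hs⟩ := id fI
  obtain ⟨J, fJ, sJ, hJ⟩ := exists_ideal_smul_mem_of_mem_qSaturation (S := S)
    (s.image (· • x)) (by
      simp only [Finset.forall_mem_image]
      exact fun a ha ↦ hI a (hs ▸ Submodule.subset_span ha))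
  simp only [Finset.forall_mem_image] at hJ
  refine ⟨J * I, Submodule.FG.mul fJ fI, sJ.mul sI, fun c hc ↦ ?_⟩
  induction hc using Submodule.mul_induction_on' with
  | mem_mul_mem b hb a ha =>
    rw [← hs] at ha
    induction ha using Submodule.span_induction with
    | mem a ha => rw [mul_smul]; exact hJ b hb ha
    | zero => simp
    | add a a' _ _ h h' => rw [mul_add, add_smul]; exact S.add_mem h h'
    | smul r a _ h => rw [smul_eq_mul, mul_left_comm, mul_smul]; exact S.smul_mem r h
  | add c _ d _ hc hd => rw [add_smul]; exact S.add_mem hc hd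

lemma isQTorsion_iff : IsQTorsion R M ↔ qSaturation (⊥ : Submodule R M) = ⊤ := by
  simp [eq_top_iff, SetLike.le_def, mem_qSaturation, IsQTorsion]

lemma isQTorsion_submodule_iff {S : Submodule R M} : IsQTorsion R S ↔ S ≤ qSaturation ⊥ := by
  have : (⊥ : Submodule R S) = (⊥ : Submodule R M).comap S.subtype := by simp
  rw [isQTorsion_iff, this, qSaturation_comap, Submodule.comap_subtype_eq_top]

lemma isQTorsion_quotient_iff {S : Submodule R M} :
    IsQTorsion R (M ⧸ S) ↔ qSaturation S = ⊤ := by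
  have : S = (⊥ : Submodule R (M ⧸ S)).comap S.mkQ := by simp
  conv_rhs => rw [this, qSaturation_comap]
  rw [isQTorsion_iff]
  refine ⟨fun h ↦ by simp [h], fun h ↦ ?_⟩
  rw [← Submodule.map_comap_eq_of_surjective S.mkQ_surjective (qSaturation ⊥), h]
  simp

lemma LinearEquiv.isQTorsion_iff (e : M ≃ₗ[R] N) : IsQTorsion R M ↔ IsQTorsion R N := by
  refine ⟨fun h x ↦ ?_, fun h x ↦ ?_⟩
  · simpa [mem_qSaturation] using map_mem_qSaturation_bot e.toLinearMap (h (e.symm x))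
  · simpa [mem_qSaturation] using map_mem_qSaturation_bot e.symm.toLinearMap (h (e x))

end QSaturation

section TensorProduct

variable {R : Type*} [CommRing R]
variable {A B C K F M : Type*} [AddCommGroup A] [Module R A] [AddCommGroup B] [Module R B]
  [AddCommGroup C] [Module R C] [AddCommGroup K] [Module R K] [AddCommGroup F] [Module R F]
  [AddCommGroup M] [Module R M]

open LinearMap

lemma rTensor_apply_lTensor_apply (f : A →ₗ[R] B) (g : K →ₗ[R] F) (t : A ⊗[R] K) :
    f.rTensor F (g.lTensor A t) = g.lTensor B (f.rTensor K t) := by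
  rw [← comp_apply, ← comp_apply, rTensor_comp_lTensor, lTensor_comp_rTensor]

/-- A torsion form of the balance of `Tor`, obtained by chasing the tensor product of two
right exact sequences. -/
lemma ker_rTensor_le_qSaturation_bot {i : A →ₗ[R] B} {p : B →ₗ[R] C} {j : K →ₗ[R] F}
    {q : F →ₗ[R] M} (hip : Function.Exact i p) (hp : Function.Surjective p)
    (hjq : Function.Exact j q) (hq : Function.Surjective q)
    (hF : Function.Injective (i.rTensor F)) (h : ker (j.lTensor C) ≤ qSaturation ⊥) :
    ker (i.rTensor M) ≤ qSaturation ⊥ := by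
  intro z hz
  obtain ⟨w, rfl⟩ := lTensor_surjective A hq z
  obtain ⟨k, hk⟩ : i.rTensor F w ∈ range (j.lTensor B) := by
    rw [← (lTensor_exact B hjq hq).linearMap_ker_eq, mem_ker, ← rTensor_apply_lTensor_apply]
    exact hz
  have hk' : k ∈ qSaturation (range (i.rTensor K)) := by
    rw [mem_qSaturation_range (rTensor_exact K hip hp)]
    refine h ?_
    rw [mem_ker, ← rTensor_apply_lTensor_apply, hk]
    exact (rTensor_exact F hip hp).apply_apply_eq_zero w
  obtain ⟨I, fI, sI, hI⟩ := hk'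
  refine ⟨I, fI, sI, fun a ha ↦ ?_⟩
  obtain ⟨y, hy⟩ := hI a ha
  have : a • w = j.lTensor A y := hF (by
    rw [map_smul, ← hk, rTensor_apply_lTensor_apply, hy, map_smul])
  rw [Submodule.mem_bot, ← map_smul, this]
  exact (lTensor_exact A hjq hq).apply_apply_eq_zero y

lemma ker_lTensor_le_qSaturation_bot_iff_rTensor {j : K →ₗ[R] F} :
    ker (j.lTensor C) ≤ qSaturation ⊥ ↔ ker (j.rTensor C) ≤ qSaturation ⊥ := by
  refine ⟨fun h x hx ↦ ?_, fun h x hx ↦ ?_⟩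
  · simpa using map_mem_qSaturation_bot (TensorProduct.comm R C K).toLinearMap
      (h (x := TensorProduct.comm R K C x) (by
        rw [mem_ker] at hx ⊢; rw [← LinearMap.comm_comp_rTensor_comp_comm_eq]; simp [hx]))
  · simpa using map_mem_qSaturation_bot (TensorProduct.comm R K C).toLinearMap
      (h (x := TensorProduct.comm R C K x) (by
        rw [mem_ker] at hx ⊢; rw [← LinearMap.comm_comp_lTensor_comp_comm_eq]; simp [hx]))

lemma ker_lTensor_le_qSaturation_bot_of_exact [Module.Flat R F] {i : A →ₗ[R] B} {p : B →ₗ[R] C}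
    {j : K →ₗ[R] F} (hi : Function.Injective i) (hip : Function.Exact i p)
    (hp : Function.Surjective p) (hA : ker (j.lTensor A) ≤ qSaturation ⊥)
    (hC : ker (j.lTensor C) ≤ qSaturation ⊥) : ker (j.lTensor B) ≤ qSaturation ⊥ := by
  intro x hx
  rw [mem_ker] at hx
  have hx' : x ∈ qSaturation (range (i.rTensor K)) := by
    rw [mem_qSaturation_range (rTensor_exact K hip hp)]
    exact hC (by rw [mem_ker, ← rTensor_apply_lTensor_apply, hx, map_zero])
  obtain ⟨I, fI, sI, hI⟩ := hx'
  rw [← qSaturation_idem]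
  refine ⟨I, fI, sI, fun a ha ↦ ?_⟩
  obtain ⟨y, hy⟩ := hI a ha
  rw [← hy]
  refine map_mem_qSaturation_bot _ (hA ?_)
  refine Module.Flat.rTensor_preserves_injective_linearMap i hi ?_
  rw [rTensor_apply_lTensor_apply, hy, map_smul, hx, smul_zero, map_zero]

lemma Submodule.exists_fg_mem_smul_top {I : Ideal R} {x : M} (hx : x ∈ I • (⊤ : Submodule R M)) :
    ∃ J ≤ I, J.FG ∧ x ∈ J • (⊤ : Submodule R M) := by
  induction hx using Submodule.smul_induction_on' with
  | smul r hr n hn =>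
    exact ⟨Ideal.span {r}, by simpa [Ideal.span_le] using hr, ⟨{r}, by simp⟩,
      Submodule.smul_mem_smul (Ideal.mem_span_singleton_self r) hn⟩
  | add x hx y hy ihx ihy =>
    obtain ⟨J, hJ, fJ, mJ⟩ := ihx
    obtain ⟨J', hJ', fJ', mJ'⟩ := ihy
    exact ⟨J ⊔ J', sup_le hJ hJ', Submodule.FG.sup fJ fJ',
      add_mem (Submodule.smul_mono_left le_sup_left mJ) (Submodule.smul_mono_left le_sup_right mJ')⟩

lemma one_tmul_eq_zero_iff {I : Ideal R} {x : M} :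
    (1 : R ⧸ I) ⊗ₜ[R] x = 0 ↔ x ∈ I • (⊤ : Submodule R M) := by
  rw [← (TensorProduct.quotTensorEquivQuotSMul M I).map_eq_zero_iff]
  have := TensorProduct.quotTensorEquivQuotSMul_mk_tmul I (1 : R) x
  rw [map_one, one_smul] at this
  rw [this, Submodule.Quotient.mk_eq_zero]

lemma ker_lTensor_quotient_le_qSaturation_bot {j : K →ₗ[R] F}
    (h : ∀ I : Ideal R, I.FG → ker (j.lTensor (R ⧸ I)) ≤ qSaturation ⊥) (I : Ideal R) :
    ker (j.lTensor (R ⧸ I)) ≤ qSaturation ⊥ := by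
  intro x hx
  obtain ⟨k, rfl⟩ : ∃ k : K, (1 : R ⧸ I) ⊗ₜ[R] k = x := by
    clear hx
    induction x with
    | zero => exact ⟨0, by simp⟩
    | add x y ihx ihy =>
      obtain ⟨k, rfl⟩ := ihx
      obtain ⟨l, rfl⟩ := ihy
      exact ⟨k + l, TensorProduct.tmul_add ..⟩
    | tmul r k =>
      obtain ⟨r, rfl⟩ := Ideal.Quotient.mk_surjective r
      exact ⟨r • k, by rw [← TensorProduct.smul_tmul, Algebra.smul_def, mul_one]; rfl⟩
  rw [mem_ker, lTensor_tmul, one_tmul_eq_zero_iff] at hx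
  obtain ⟨J, hJ, fJ, mJ⟩ := Submodule.exists_fg_mem_smul_top hx
  have := map_mem_qSaturation_bot ((Submodule.factor hJ).rTensor K)
    (h J fJ (x := 1 ⊗ₜ k) (by rwa [mem_ker, lTensor_tmul, one_tmul_eq_zero_iff]))
  simpa using this

lemma ker_lTensor_le_qSaturation_bot_of_quotient [Module.Flat R F] {j : K →ₗ[R] F}
    (h : ∀ I : Ideal R, I.FG → ker (j.lTensor (R ⧸ I)) ≤ qSaturation ⊥) :
    ker (j.lTensor C) ≤ qSaturation ⊥ := by
  have fg (s : Finset C) : ker (j.lTensor (Submodule.span R (s : Set C))) ≤ qSaturation ⊥ := by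
    induction s using Finset.cons_induction with
    | empty =>
      intro x _
      have : Subsingleton (Submodule.span R ((∅ : Finset C) : Set C)) := by
        rw [Finset.coe_empty, Submodule.span_empty]
        infer_instance
      rw [Subsingleton.elim x 0]
      exact zero_mem _
    | cons c s hc ih =>
      have hle : Submodule.span R (s : Set C) ≤ Submodule.span R (Finset.cons c s hc : Set C) :=
        Submodule.span_mono (by simp)
      let S := range (Submodule.inclusion hle)
      let g : R →ₗ[R] (_ ⧸ S) := toSpanSingleton R _
        (S.mkQ ⟨c, Submodule.subset_span (by simp)⟩)
      have hg : Function.Surjective g := by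
        intro y
        obtain ⟨⟨y, hy⟩, rfl⟩ := S.mkQ_surjective y
        obtain ⟨a, z, hz, rfl⟩ := Submodule.mem_span_insert.1 (by simpa using hy)
        refine ⟨a, ?_⟩
        rw [toSpanSingleton_apply, ← map_smul, ← sub_eq_zero, ← map_sub, Submodule.mkQ_apply,
          Submodule.Quotient.mk_eq_zero]
        exact ⟨-⟨z, hz⟩, by ext; simp⟩
      let e := g.quotKerEquivOfSurjective hg
      refine ker_lTensor_le_qSaturation_bot_of_exact (Submodule.inclusion_injective hle)
        (p := e.symm.toLinearMap ∘ₗ S.mkQ) ?_ (e.symm.surjective.comp S.mkQ_surjective) ih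
        (ker_lTensor_quotient_le_qSaturation_bot h (ker g))
      intro y
      simp [S]
  intro x hx
  obtain ⟨S, hS, hx'⟩ := TensorProduct.exists_finite_submodule_left_of_setFinite {x}
    (Set.finite_singleton x)
  obtain ⟨y, rfl⟩ := hx' rfl
  obtain ⟨s, rfl⟩ := Module.Finite.iff_fg.1 hS
  refine map_mem_qSaturation_bot _ (fg s ?_)
  refine Module.Flat.rTensor_preserves_injective_linearMap (M := F)
    (Submodule.span R (s : Set C)).subtype Subtype.val_injective ?_
  rw [rTensor_apply_lTensor_apply, map_zero]
  exact hx

lemma ker_lTensor_le_qSaturation_bot_of_isQTorsion {i : A →ₗ[R] B}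
    (hi : ker i ≤ qSaturation ⊥)
    (h : ker ((ker i).liftQ i le_rfl |>.lTensor M) ≤ qSaturation ⊥) :
    ker (i.lTensor M) ≤ qSaturation ⊥ := by
  intro x hx
  have hk : range ((ker i).subtype.lTensor M) ≤ qSaturation ⊥ := by
    rintro _ ⟨y, rfl⟩
    induction y with
    | zero => simp
    | add x y hx hy => rw [map_add]; exact add_mem hx hy
    | tmul m k => exact map_mem_qSaturation_bot (TensorProduct.mk R M A m) (hi k.2)
  rw [← qSaturation_idem]
  refine qSaturation_mono hk ?_
  rw [mem_qSaturation_range (lTensor_exact M (exact_subtype_mkQ (ker i))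
    (Submodule.mkQ_surjective _))]
  refine h ?_
  rw [mem_ker, ← comp_apply, ← lTensor_comp, Submodule.liftQ_mkQ]
  exact hx

end TensorProduct

section Tor

open CategoryTheory LinearMap

lemma CategoryTheory.ShortComplex.isQTorsion_homology_iff {R : Type u} [CommRing R]
    (S : ShortComplex (ModuleCat.{v} R)) :
    IsQTorsion R S.homology ↔ ker S.g.hom ≤ qSaturation (range S.f.hom) := by
  have e : S.homology ≃ₗ[R] (ker S.g.hom ⧸ range S.moduleCatToCycles) :=
    S.moduleCatHomologyIso.toLinearEquiv
  have hr : range S.moduleCatToCycles = (range S.f.hom).comap (ker S.g.hom).subtype := by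
    ext x
    rw [Submodule.mem_comap, mem_range, mem_range]
    exact exists_congr fun y ↦ Subtype.ext_iff
  rw [e.isQTorsion_iff, isQTorsion_quotient_iff, hr, qSaturation_comap,
    Submodule.comap_subtype_eq_top]

lemma exists_flat_presentation_tor (R : Type u) [CommRing R] (N : Type u) [AddCommGroup N]
    [Module R N] :
    ∃ (K F : Type u) (_ : AddCommGroup K) (_ : Module R K) (_ : AddCommGroup F) (_ : Module R F)
      (j : K →ₗ[R] F) (q : F →ₗ[R] N), Module.Flat R F ∧ Function.Injective j ∧
      Function.Exact j q ∧ Function.Surjective q ∧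
      ∀ (X : Type u) [AddCommGroup X] [Module R X],
        IsQTorsion R (Tor1Mod R X N) ↔ ker (j.lTensor X) ≤ qSaturation ⊥ := by
  let P := projectiveResolution (ModuleCat.of R N)
  let d₁ := (P.complex.d 1 0).hom
  let d₂ := (P.complex.d 2 1).hom
  have hproj : Module.Projective R (P.complex.X 0) :=
    (IsProjective.iff_projective _).2 (P.projective 0)
  let q : P.complex.X 0 →ₗ[R] N := (P.π.f 0).hom
  have hq : Function.Exact d₁ q :=
    (ShortComplex.ShortExact.moduleCat_exact_iff_function_exact _).1 P.exact₀
  have hs : Function.Surjective q := (ModuleCat.epi_iff_surjective _).1 inferInstance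
  have hd : Function.Exact d₂ d₁ :=
    (ShortComplex.ShortExact.moduleCat_exact_iff_function_exact _).1 (P.exact_succ 0)
  refine ⟨range d₁, P.complex.X 0, inferInstance, inferInstance, inferInstance, inferInstance,
    (range d₁).subtype, q, inferInstance, Subtype.val_injective, ?_, hs, ?_⟩
  · intro x
    rw [hq x, Submodule.coe_subtype, Subtype.range_coe]
    rfl
  · intro X _ _
    let G := (MonoidalCategory.tensoringLeft (ModuleCat.{u} R)).obj (ModuleCat.of R X)
    let D := (G.mapHomologicalComplex _).obj P.complex
    have e : Tor1Mod R X N ≅ (D.sc' 2 1 0).homology :=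
      P.isoLeftDerivedObj G 1 ≪≫ ShortComplex.homologyMapIso (D.isoSc' 2 1 0 (by simp) (by simp))
    have hr : Function.Exact d₂ d₁.rangeRestrict := by
      intro x
      rw [← hd x, Subtype.ext_iff]
      rfl
    have hex := lTensor_exact X hr d₁.surjective_rangeRestrict
    rw [e.toLinearEquiv.isQTorsion_iff, ShortComplex.isQTorsion_homology_iff]
    change ker (d₁.lTensor X) ≤ qSaturation (range (d₂.lTensor X)) ↔ _
    have hc (x : X ⊗[R] P.complex.X 1) : d₁.lTensor X x =
        (range d₁).subtype.lTensor X (d₁.rangeRestrict.lTensor X x) := by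
      rw [← LinearMap.comp_apply, ← lTensor_comp]
      rfl
    refine ⟨fun h y hy ↦ ?_, fun h x hx ↦ ?_⟩
    · obtain ⟨x, rfl⟩ := lTensor_surjective X d₁.surjective_rangeRestrict y
      exact (mem_qSaturation_range hex).1 (h ((hc x).trans hy))
    · exact (mem_qSaturation_range hex).2 (h ((hc x).symm.trans hx))

end Tor

/-- For an `R`-module `M` the following are equivalent:
(1) `M` is τ_q-flat: for every linear map `f : A → B` with Q-torsion kernel, the
kernel of `M ⊗ A → M ⊗ B` is Q-torsion;
(2) `Tor_1^R(M, N)` is Q-torsion for every `R`-module `N`;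
(3) `Tor_1^R(R/I, M)` is Q-torsion for every finitely generated ideal `I`. -/
theorem statement9 (R : Type u) [CommRing R] (M : Type u) [AddCommGroup M] [Module R M] :
    List.TFAE
      [∀ (A B : Type u) [AddCommGroup A] [AddCommGroup B] [Module R A] [Module R B]
        (f : A →ₗ[R] B), IsQTorsion R (LinearMap.ker f) →
          IsQTorsion R (LinearMap.ker (LinearMap.lTensor M f)),
      ∀ (N : Type u) [AddCommGroup N] [Module R N], IsQTorsion R (Tor1Mod R M N),
      ∀ I : Ideal R, I.FG → IsQTorsion R (Tor1Mod R (R ⧸ I) M)] := by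
  tfae_have 1 → 2 := by
    intro h N _ _
    obtain ⟨K, F, _, _, _, _, j, q, -, hj, -, -, hT⟩ := exists_flat_presentation_tor R N
    rw [hT, ← isQTorsion_submodule_iff]
    refine h K F j ?_
    rw [isQTorsion_submodule_iff, LinearMap.ker_eq_bot.2 hj]
    exact bot_le
  tfae_have 2 → 3 := by
    intro h I _
    obtain ⟨K, F, _, _, _, _, j, q, _, hj, hjq, hq, hT⟩ := exists_flat_presentation_tor R M
    obtain ⟨K', F', _, _, _, _, j', q', _, hj', hjq', hq', hT'⟩ :=
      exists_flat_presentation_tor R (R ⧸ I)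
    rw [hT, ker_lTensor_le_qSaturation_bot_iff_rTensor]
    exact ker_rTensor_le_qSaturation_bot hjq hq hjq' hq'
      (Module.Flat.rTensor_preserves_injective_linearMap j hj) ((hT' M).1 (h (R ⧸ I)))
  tfae_have 3 → 1 := by
    intro h A B _ _ _ _ f hf
    obtain ⟨K, F, _, _, _, _, j, q, _, hj, hjq, hq, hT⟩ := exists_flat_presentation_tor R M
    rw [isQTorsion_submodule_iff] at hf ⊢
    refine ker_lTensor_le_qSaturation_bot_of_isQTorsion hf ?_
    rw [ker_lTensor_le_qSaturation_bot_iff_rTensor]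
    have hinj : Function.Injective ((LinearMap.ker f).liftQ f le_rfl) :=
      LinearMap.ker_eq_bot.1 (Submodule.ker_liftQ_eq_bot _ _ _ le_rfl)
    exact ker_rTensor_le_qSaturation_bot (LinearMap.exact_map_mkQ_range _)
      (Submodule.mkQ_surjective _) hjq hq
      (Module.Flat.rTensor_preserves_injective_linearMap _ hinj)
      (ker_lTensor_le_qSaturation_bot_of_quotient fun I hI ↦ (hT _).1 (h I hI))
  tfae_finish
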